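/- Bertrand's postulate for lucky numbers: for every real x ≥ 4 there exists a lucky number l with x ≤ l ≤ 2x. -/

import Mathlib

open scoped BigOperators

namespace LuckyPaper

/-- Rank of `k` in `A`: the number of elements of `A` that are `≤ k`
(the 1-indexed position of `k` in `A` when `k ∈ A`). -/
noncomputable def rank (A : Set ℕ) (k : ℕ) : ℕ := Set.ncard {m | m ∈ A ∧ m ≤ k}

/-- One sieve step: delete every `d`-th element of `A` (listed in increasing order). -/
noncomputable def step (A : Set ℕ) (d : ℕ) : Set ℕ := {k | k ∈ A ∧ ¬ d ∣ rank A k}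

/-- The lucky sieve: `sieve i = (A_i, l_i)`, where `A_0 = {1,2,3,…}`, `l_0 = 1` (dummy),
`l_{i+1}` is the smallest element of `A_i` larger than `l_i`, and `A_{i+1}` is obtained
from `A_i` by deleting every `l_{i+1}`-th element.  In particular `l_1 = 2`. -/
noncomputable def sieve : ℕ → Set ℕ × ℕ
  | 0 => ({n | 1 ≤ n}, 1)
  | i + 1 =>
      let p := sieve i
      let d := sInf {m | m ∈ p.1 ∧ p.2 < m}
      (step p.1 d, d)

/-- `A i` : the set of survivors after `i` steps of the lucky sieve. -/
noncomputable def A (i : ℕ) : Set ℕ := (sieve i).1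

/-- `l i` : the `i`-th sieve parameter (`l 1 = 2`, `l 2 = 3`, `l 3 = 7`, `l 4 = 9`, …);
with this convention `l n` is the `n`-th lucky number for `n ≥ 2`. -/
noncomputable def l (i : ℕ) : ℕ := (sieve i).2

/-- The set of lucky numbers `A_∞ = ⋂ i, A i = {1, 3, 7, 9, 13, 15, 21, 25, …}`. -/
noncomputable def LuckySet : Set ℕ := ⋂ i, A i

/-- `L x` : the number of lucky numbers that are `≤ x`. -/
noncomputable def L (x : ℝ) : ℕ := Set.ncard {m | m ∈ LuckySet ∧ (m : ℝ) ≤ x}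

/-- `R i x = #{k ∈ A_{i-1} : k ≤ x}`. -/
noncomputable def R (i : ℕ) (x : ℝ) : ℕ := Set.ncard {m | m ∈ A (i - 1) ∧ (m : ℝ) ≤ x}

/-- `𝕃 = {l 1, l 2, l 3, …} = {2, 3, 7, 9, 13, …}`. -/
noncomputable def Ell : Set ℕ := {a | ∃ i, 1 ≤ i ∧ l i = a}

/-- `starIdx i m` : the `m`-th number deleted at step `i` of the sieve, i.e. the
`(l i * m)`-th smallest element of `A (i-1)` (`Nat.nth` is 0-indexed). -/
noncomputable def starIdx (i m : ℕ) : ℕ := Nat.nth (· ∈ A (i - 1)) (l i * m - 1)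

/-- The binary operation `*` : for `a ∈ 𝕃`, `star a m = a * m` is the `m`-th number
deleted at the (unique) step `i ≥ 1` with `l i = a`. -/
noncomputable def star (a m : ℕ) : ℕ := starIdx (sInf {i | 1 ≤ i ∧ l i = a}) m

/-- `evalStar [a₁, …, a_k] = a₁ * (a₂ * (⋯ * a_k)⋯)`. -/
noncomputable def evalStar : List ℕ → ℕ
  | [] => 1
  | [a] => a
  | a :: b :: rest => star a (evalStar (b :: rest))

/-- `t = (a₁, …, a_k)` is a lucky factorization of `n` : `k ≥ 1`, `a_j ∈ 𝕃` for `j < k`,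
`a_k` is a lucky number (possibly 1), and `n = a₁*(a₂*(⋯*a_k)⋯)`. -/
def IsLuckyFactorization (n : ℕ) (t : List ℕ) : Prop :=
  t ≠ [] ∧ (∀ a ∈ t.dropLast, a ∈ Ell) ∧ t.getLast! ∈ LuckySet ∧ evalStar t = n

/-- The canonical tuple of `n` given by the fundamental theorem of arithmetic
for lucky numbers. -/
noncomputable def canonicalTuple (n : ℕ) : List ℕ :=
  haveI := Classical.propDecidable (∃ t, IsLuckyFactorization n t)
  if h : ∃ t, IsLuckyFactorization n t then h.choose else []

/-- `Ω°(n)` : the length of the canonical tuple of `n`. -/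
noncomputable def bigOmega (n : ℕ) : ℕ := (canonicalTuple n).length

/-- `ω°(n)` : the number of distinct entries of the canonical tuple of `n`. -/
noncomputable def smallOmega (n : ℕ) : ℕ := (canonicalTuple n).dedup.length

/-- `d°(n)` : the number of distinct nonempty contiguous subtuples (infixes) of the
canonical tuple of `n`. -/
noncomputable def dCirc (n : ℕ) : ℕ :=
  Set.ncard {s : List ℕ | s ≠ [] ∧ s <:+: canonicalTuple n}

/-- `B` : positive integers whose canonical tuple has last entry `≠ 1`. -/
noncomputable def Bset : Set ℕ := {n | 1 ≤ n ∧ (canonicalTuple n).getLast! ≠ 1}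

/-- `C` : positive integers whose canonical tuple ends with the pair `(2, 1)`. -/
noncomputable def Cset : Set ℕ := {n | 1 ≤ n ∧ ∃ t, canonicalTuple n = t ++ [2, 1]}

/-- `S = B ∪ C`. -/
noncomputable def Sset : Set ℕ := Bset ∪ Cset

/-- The `𝕃`-tuple of `a ∈ S` : the canonical tuple of `a` if it does not end in `1`,
else the canonical tuple with the final `1` removed (so it ends in `2`). -/
noncomputable def ellTuple (a : ℕ) : List ℕ :=
  if (canonicalTuple a).getLast! = 1 then (canonicalTuple a).dropLast else canonicalTuple a

/-- The extended operation `∘` : if the `𝕃`-tuple of `a` is `(t₁, …, t_k)`, then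
`a ∘ b = t₁*(t₂*(⋯*(t_k*b)⋯))`. -/
noncomputable def circ (a b : ℕ) : ℕ := (ellTuple a).foldr star b


lemma finite_rank_set (S : Set ℕ) (x : ℕ) : {m | m ∈ S ∧ m ≤ x}.Finite :=
  (Set.finite_Iic x).subset fun _ hm => hm.2

lemma rank_succ_of_mem {S : Set ℕ} {x : ℕ} (h : x + 1 ∈ S) :
    rank S (x + 1) = rank S x + 1 := by
  have hset : {m | m ∈ S ∧ m ≤ x + 1} = insert (x + 1) {m | m ∈ S ∧ m ≤ x} := by
    ext m
    simp only [Set.mem_ofPred_eq, Set.mem_insert_iff]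
    constructor
    · rintro ⟨hm, hle⟩
      rcases Nat.lt_or_ge x m with hlt | hge
      · exact Or.inl (by omega)
      · exact Or.inr ⟨hm, hge⟩
    · rintro (rfl | ⟨hm, hle⟩)
      · exact ⟨h, le_rfl⟩
      · exact ⟨hm, by omega⟩
  unfold rank
  rw [hset, Set.ncard_insert_of_notMem (fun hm => by have := hm.2; omega) (finite_rank_set S x)]

lemma rank_succ_of_notMem {S : Set ℕ} {x : ℕ} (h : x + 1 ∉ S) :
    rank S (x + 1) = rank S x := by
  unfold rank
  congr 1
  ext m
  simp only [Set.mem_ofPred_eq]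
  constructor
  · rintro ⟨hm, hle⟩
    have : m ≠ x + 1 := fun he => h (he ▸ hm)
    exact ⟨hm, by omega⟩
  · rintro ⟨hm, hle⟩
    exact ⟨hm, by omega⟩

lemma rank_zero {S : Set ℕ} (h : 0 ∉ S) : rank S 0 = 0 := by
  have hset : {m | m ∈ S ∧ m ≤ 0} = ∅ := by
    ext m
    simp only [Set.mem_ofPred_eq, Set.mem_empty_iff_false, iff_false]
    rintro ⟨hm, hle⟩
    exact h (Nat.le_zero.mp hle ▸ hm)
  unfold rank
  rw [hset, Set.ncard_empty]

lemma rank_pos_nat (x : ℕ) : rank {n | 1 ≤ n} x = x := by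
  induction x with
  | zero => exact rank_zero (by simp)
  | succ x ih => rw [rank_succ_of_mem (by simp), ih]

/-- Counting form of a sieve step, additively. -/
lemma rank_step_add {S : Set ℕ} (h0 : 0 ∉ S) (d x : ℕ) :
    rank (step S d) x + rank S x / d = rank S x := by
  induction x with
  | zero => rw [rank_zero h0, rank_zero fun h => h0 h.1]; simp
  | succ x ih =>
    by_cases hx : x + 1 ∈ S
    · have hr := rank_succ_of_mem hx
      by_cases hd : d ∣ rank S x + 1
      · have hn : x + 1 ∉ step S d := fun h => h.2 (hr ▸ hd)
        rw [rank_succ_of_notMem hn, hr, Nat.succ_div_of_dvd hd]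
        omega
      · have hm : x + 1 ∈ step S d := ⟨hx, hr ▸ hd⟩
        rw [rank_succ_of_mem hm, hr, Nat.succ_div_of_not_dvd hd]
        omega
    · rw [rank_succ_of_notMem hx, rank_succ_of_notMem fun h => hx h.1, ih]

lemma rank_step {S : Set ℕ} (h0 : 0 ∉ S) (d x : ℕ) :
    rank (step S d) x = rank S x - rank S x / d := by
  have := rank_step_add h0 d x
  omega

lemma exists_mem_of_rank_lt {S : Set ℕ} {x y : ℕ} (h : rank S x < rank S y) :
    ∃ n ∈ S, x < n ∧ n ≤ y := by
  by_contra! hne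
  refine h.not_ge (Set.ncard_le_ncard (fun m hm => ⟨hm.1, ?_⟩) (finite_rank_set S x))
  by_contra! hlt
  exact (hne m hm.1 hlt).not_ge hm.2

lemma sub_div_mono {d : ℕ} (hd : 0 < d) {a b : ℕ} (h : a ≤ b) : a - a / d ≤ b - b / d := by
  obtain ⟨e, rfl⟩ := Nat.exists_eq_add_of_le h
  have h1 : (a + e) / d ≤ (a + e * d) / d :=
    Nat.div_le_div_right (Nat.add_le_add_left (Nat.le_mul_of_pos_right e hd) a)
  rw [Nat.add_mul_div_right _ _ hd] at h1
  have := Nat.div_le_self a d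
  omega

lemma two_mul_sub_div_le {d : ℕ} (hd : 0 < d) {a b i : ℕ} (h : 2 * a ≤ b + i) :
    2 * (a - a / d) ≤ b - b / d + (i + 1) := by
  have h1 : min b (2 * a) - min b (2 * a) / d ≤ b - b / d := sub_div_mono hd (min_le_left _ _)
  have h2 : min b (2 * a) / d ≤ 2 * a / d := Nat.div_le_div_right (min_le_right _ _)
  have h3 : 2 * a / d < 2 * (a / d) + 2 := by
    rw [Nat.div_lt_iff_lt_mul hd]
    have := Nat.lt_div_mul_add (a := a) hd
    nlinarith
  have := Nat.div_le_self a d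
  omega

lemma A_succ (i : ℕ) : A (i + 1) = step (A i) (l (i + 1)) := rfl

lemma l_succ (i : ℕ) : l (i + 1) = sInf {m | m ∈ A i ∧ l i < m} := rfl

lemma A_antitone : Antitone A :=
  antitone_nat_of_succ_le fun i => by
    rw [A_succ]
    exact fun _ h => h.1

lemma zero_notMem_A (i : ℕ) : 0 ∉ A i := fun h =>
  absurd (show 1 ≤ 0 from A_antitone (Nat.zero_le i) h) (by omega)

lemma rank_A_zero (x : ℕ) : rank (A 0) x = x := rank_pos_nat x

lemma rank_A_succ (i x : ℕ) :
    rank (A (i + 1)) x = rank (A i) x - rank (A i) x / l (i + 1) :=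
  rank_step (zero_notMem_A i) _ _

lemma exists_lt_of_rank_unbounded {S : Set ℕ} (h : ∀ k, ∃ x, k ≤ rank S x) (y : ℕ) :
    ∃ n ∈ S, y < n := by
  obtain ⟨x, hx⟩ := h (rank S y + 1)
  obtain ⟨n, hn, hlt, -⟩ := exists_mem_of_rank_lt (Nat.lt_of_succ_le hx)
  exact ⟨n, hn, hlt⟩

lemma l_succ_mem_of_unbounded {i : ℕ} (h : ∀ k, ∃ x, k ≤ rank (A i) x) :
    l (i + 1) ∈ A i ∧ l i < l (i + 1) := by
  rw [l_succ]
  exact Nat.sInf_mem (exists_lt_of_rank_unbounded h (l i))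

lemma rank_A_unbounded_and_l_pos (i : ℕ) : (∀ k, ∃ x, k ≤ rank (A i) x) ∧ 1 ≤ l i := by
  induction i with
  | zero => exact ⟨fun k => ⟨k, (rank_A_zero k).ge⟩, le_rfl⟩
  | succ i ih =>
    obtain ⟨hu, hl⟩ := ih
    have hlt := (l_succ_mem_of_unbounded hu).2
    refine ⟨fun k => ?_, by omega⟩
    obtain ⟨x, hx⟩ := hu (2 * k)
    refine ⟨x, ?_⟩
    rw [rank_A_succ]
    have : rank (A i) x / l (i + 1) ≤ rank (A i) x / 2 :=
      Nat.div_le_div_left (by omega) (by omega)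
    omega

lemma l_succ_mem (i : ℕ) : l (i + 1) ∈ A i :=
  (l_succ_mem_of_unbounded (rank_A_unbounded_and_l_pos i).1).1

lemma l_lt_l_succ (i : ℕ) : l i < l (i + 1) :=
  (l_succ_mem_of_unbounded (rank_A_unbounded_and_l_pos i).1).2

lemma l_pos (i : ℕ) : 0 < l i := (rank_A_unbounded_and_l_pos i).2

lemma l_one : l 1 = 2 := by
  have h : l 1 ≤ 2 := by
    rw [l_succ]
    exact Nat.sInf_le ⟨show 1 ≤ 2 by omega, show 1 < 2 by omega⟩
  have := l_lt_l_succ 0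
  have := l_pos 0
  simp only [zero_add] at *
  omega

lemma mem_A_one {n : ℕ} : n ∈ A 1 ↔ n % 2 = 1 := by
  have h : n ∈ A 1 ↔ 1 ≤ n ∧ ¬ l 1 ∣ rank (A 0) n := Iff.rfl
  rw [h, l_one, rank_A_zero]
  omega

lemma l_add_two_odd (i : ℕ) : l (i + 2) % 2 = 1 :=
  mem_A_one.mp (A_antitone (by omega) (l_succ_mem (i + 1)))

lemma two_mul_add_three_le_l (i : ℕ) : 2 * i + 3 ≤ l (i + 2) := by
  induction i with
  | zero =>
    have : l 1 < l 2 := l_lt_l_succ 1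
    rw [l_one] at this
    exact this
  | succ i ih =>
    have h1 := l_lt_l_succ (i + 2)
    have h2 := l_add_two_odd i
    have h3 := l_add_two_odd (i + 1)
    rw [show i + 1 + 2 = i + 2 + 1 by ring] at *
    omega

lemma l_two : l 2 = 3 := by
  have h1 : l 2 ≤ 3 := by
    rw [l_succ]
    exact Nat.sInf_le ⟨mem_A_one.mpr (by norm_num), by rw [l_one]; norm_num⟩
  have h2 := two_mul_add_three_le_l 0
  simp only [zero_add] at h2
  omega

lemma rank_A_antitone (x : ℕ) : Antitone fun i => rank (A i) x :=
  antitone_nat_of_succ_le fun i => by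
    rw [rank_A_succ]
    exact Nat.sub_le _ _

/-- A count smaller than every later sieve parameter is never reduced again. -/
lemma le_rank_A_of_lt_l {i j k x : ℕ} (hk : k ≤ rank (A i) x)
    (hl : ∀ s, i < s → k < l s) (hij : i ≤ j) : k ≤ rank (A j) x := by
  induction j, hij using Nat.le_induction with
  | base => exact hk
  | succ j hij ih =>
    rw [rank_A_succ]
    have h := sub_div_mono (l_pos (j + 1)) ih
    rwa [Nat.div_eq_of_lt (hl (j + 1) (by omega)), Nat.sub_zero] at h

lemma lt_l_of_le {k s : ℕ} (hk : 3 ≤ k) (hs : k ≤ s) : k + 1 < l s := by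
  obtain ⟨t, rfl⟩ := Nat.exists_eq_add_of_le (show 2 ≤ s by omega)
  have := two_mul_add_three_le_l t
  rw [add_comm 2 t]
  omega

lemma three_le_rank_A {x : ℕ} (hx : 7 ≤ x) (i : ℕ) : 3 ≤ rank (A i) x := by
  have h1 : 4 ≤ rank (A 1) x := by
    rw [rank_A_succ, rank_A_zero, zero_add, l_one]
    omega
  have h2 : 3 ≤ rank (A 2) x := by
    rw [rank_A_succ, show 1 + 1 = 2 from rfl, l_two]
    omega
  rcases le_total 2 i with hi | hi
  · refine le_rank_A_of_lt_l h2 (fun s hs => ?_) hi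
    have := lt_l_of_le le_rfl (show 3 ≤ s from hs)
    omega
  · exact h2.trans (rank_A_antitone x hi)

lemma two_mul_rank_A_le (N i : ℕ) : 2 * rank (A i) N ≤ rank (A i) (2 * N) + i := by
  induction i with
  | zero => simp [rank_A_zero]
  | succ i ih =>
    rw [rank_A_succ, rank_A_succ]
    exact two_mul_sub_div_le (l_pos _) ih

/-- If a half-open interval meets all late stages of the sieve, it contains a lucky number. -/
lemma exists_lucky_of_rank_lt {x y i₀ : ℕ} (h : ∀ i, i₀ ≤ i → rank (A i) x < rank (A i) y) :
    ∃ n ∈ LuckySet, x < n ∧ n ≤ y := by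
  by_contra! hne
  have hout : ∀ n, ∃ i, x < n → n ≤ y → n ∉ A i := by
    intro n
    by_contra! hn
    have hmem : n ∈ LuckySet := Set.mem_iInter.mpr fun i => (hn i).2.2
    exact (hne n hmem (hn 0).1).not_ge (hn 0).2.1
  choose f hf using hout
  let j := max i₀ ((Finset.Iic y).sup f)
  obtain ⟨n, hn, hlt, hle⟩ := exists_mem_of_rank_lt (h j (le_max_left _ _))
  have hfn : f n ≤ j := (Finset.le_sup (Finset.mem_Iic.mpr hle)).trans (le_max_right _ _)
  exact hf n hlt hle (A_antitone hfn hn)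

lemma seven_mem_LuckySet : 7 ∈ LuckySet := by
  have h6 : rank (A 2) 6 = 2 := by
    rw [rank_A_succ, rank_A_succ, rank_A_zero, zero_add, l_one, show 1 + 1 = 2 from rfl, l_two]
  obtain ⟨n, hn, hlt, hle⟩ := exists_lucky_of_rank_lt (x := 6) (y := 7) (i₀ := 2) fun i hi =>
    ((rank_A_antitone 6 hi).trans_eq h6).trans_lt (three_le_rank_A le_rfl i)
  rwa [show n = 7 by omega] at hn

lemma exists_lucky_between {N : ℕ} (hN : 7 ≤ N) : ∃ n ∈ LuckySet, N < n ∧ n ≤ 2 * N := by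
  obtain ⟨i₀, hi₀⟩ : ∃ i₀, ∀ i, rank (A i₀) N ≤ rank (A i) N := by
    obtain ⟨i₀, h⟩ := Nat.sInf_mem (Set.range_nonempty fun i => rank (A i) N)
    exact ⟨i₀, fun i => h.trans_le (Nat.sInf_le ⟨i, rfl⟩)⟩
  obtain ⟨k, hk⟩ : ∃ k, k = rank (A i₀) N := ⟨_, rfl⟩
  have hk3 : 3 ≤ k := hk ▸ three_le_rank_A hN i₀
  have hstart : k + 1 ≤ rank (A (k - 1)) (2 * N) := by
    have h1 := two_mul_rank_A_le N (k - 1)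
    have h2 := hi₀ (k - 1)
    omega
  refine exists_lucky_of_rank_lt (i₀ := max i₀ (k - 1)) fun i hi => ?_
  have hb : k + 1 ≤ rank (A i) (2 * N) :=
    le_rank_A_of_lt_l hstart (fun s hs => lt_l_of_le hk3 (by omega))
      ((le_max_right _ _).trans hi)
  have ha : rank (A i) N ≤ rank (A i₀) N := rank_A_antitone N ((le_max_left _ _).trans hi)
  omega

/-- Bertrand's postulate for lucky numbers: for every real `x ≥ 4` there
is a lucky number `l` with `x ≤ l ≤ 2x`. -/
theorem bertrand_lucky (x : ℝ) (hx : 4 ≤ x) :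
    ∃ n ∈ LuckySet, x ≤ (n : ℝ) ∧ (n : ℝ) ≤ 2 * x := by
  rcases le_or_gt x 7 with h7 | h7
  · exact ⟨7, seven_mem_LuckySet, by exact_mod_cast h7, by push_cast; linarith⟩
  · obtain ⟨n, hn, hlt, hle⟩ := exists_lucky_between (Nat.le_floor (by exact_mod_cast h7.le))
    refine ⟨n, hn, ((Nat.floor_lt (by linarith)).mp hlt).le, ?_⟩
    have h1 : (n : ℝ) ≤ 2 * (⌊x⌋₊ : ℝ) := by exact_mod_cast hle
    linarith [Nat.floor_le (show 0 ≤ x by linarith)]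

end LuckyPaper
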